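/- arXiv:2012.04560 — 2 statements merged into one kernel-verified Lean document; each statement's English description precedes it below -/
import Mathlib

section
/- For all integers i, j ≥ 3 with i ≠ 5 and j ≠ 5, the P_5-chromatic number of the Cartesian product of a path and a cycle satisfies s_5(P_i □ C_j) = 4. -/
open SimpleGraph

/-- `f` is a `P_k`-coloring of `G`: a proper vertex coloring such that no path on `k`
vertices is bicolored, i.e. every path on `k` vertices receives at least 3 distinct colors. -/
def IsPkColoring {V α : Type*} [DecidableEq α] (G : SimpleGraph V) (k : ℕ) (f : V → α) : Prop :=
  (∀ u w : V, G.Adj u w → f u ≠ f w) ∧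
  ∀ (u w : V) (p : G.Walk u w), p.IsPath → p.length + 1 = k →
    3 ≤ (p.support.map f).toFinset.card

/-- The `P_k`-chromatic number: the least number of colors of a `P_k`-coloring. -/
noncomputable def pkChrom {V : Type*} (G : SimpleGraph V) (k : ℕ) : ℕ :=
  sInf {n : ℕ | ∃ f : V → Fin n, IsPkColoring G k f}


/-- A coloring is a `P_5`-coloring iff it is proper and no path on five vertices alternates
between two colors. -/
theorem isPkColoring_five_iff {V α : Type*} [DecidableEq α] {G : SimpleGraph V} {f : V → α} :
    IsPkColoring G 5 f ↔ (∀ u w : V, G.Adj u w → f u ≠ f w) ∧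
      ∀ v₀ v₁ v₂ v₃ v₄ : V, G.Adj v₀ v₁ → G.Adj v₁ v₂ → G.Adj v₂ v₃ → G.Adj v₃ v₄ →
        [v₀, v₁, v₂, v₃, v₄].Nodup → f v₁ = f v₃ → f v₀ = f v₂ → f v₄ ≠ f v₂ := by
  refine and_congr_right fun hproper => ⟨fun h v₀ v₁ v₂ v₃ v₄ h₁ h₂ h₃ h₄ hnd e₁ e₂ e₃ => ?_,
    fun h u w p hp hlen => ?_⟩
  · have hcard := h v₀ v₄ (.cons h₁ (.cons h₂ (.cons h₃ (.cons h₄ .nil))))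
      (by rw [Walk.isPath_def]; simpa using hnd) rfl
    have hle : ([v₀, v₁, v₂, v₃, v₄].map f).toFinset ⊆ {f v₂, f v₃} := by
      intro x
      simp only [List.map_cons, List.map_nil, List.mem_toFinset, List.mem_cons,
        Finset.mem_insert, Finset.mem_singleton, e₁, e₂, e₃]
      simp +contextual [or_imp]
    have := (Finset.card_le_card hle).trans Finset.card_le_two
    simp only [Walk.support_cons, Walk.support_nil] at hcard
    omega
  · match p, hp, hlen with
    | .cons (v := v₁) h₁ (.cons (v := v₂) h₂ (.cons (v := v₃) h₃ (.cons h₄ .nil))), hp, _ =>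
      have hnd := hp.support_nodup
      simp only [Walk.support_cons, Walk.support_nil] at hnd ⊢
      have key := h u v₁ v₂ v₃ w h₁ h₂ h₃ h₄ hnd
      have n₁ := hproper _ _ h₁
      have n₂ := hproper _ _ h₂
      have n₃ := hproper _ _ h₃
      have n₄ := hproper _ _ h₄
      refine Finset.two_lt_card.2 ?_
      simp only [List.mem_toFinset, List.map_cons, List.map_nil, List.mem_cons]
      by_cases e₁ : f v₁ = f v₃
      · by_cases e₂ : f u = f v₂
        · exact ⟨f w, by simp, f v₂, by simp, f v₁, by simp, key e₁ e₂, by grind, by grind⟩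
        · exact ⟨f u, by simp, f v₂, by simp, f v₁, by simp, e₂, n₁, by grind⟩
      · exact ⟨f v₁, by simp, f v₂, by simp, f v₃, by simp, n₂, e₁, n₃⟩

/-- `P_k`-colorings pull back along injective homomorphisms. -/
theorem IsPkColoring.comp {V W α : Type*} [DecidableEq α] {G : SimpleGraph V}
    {H : SimpleGraph W} {k : ℕ} {f : W → α} (hf : IsPkColoring H k f) (φ : G →g H)
    (hφ : Function.Injective φ) : IsPkColoring G k (f ∘ φ) := by
  refine ⟨fun u w h => hf.1 _ _ (φ.map_rel h), fun u w p hp hlen => ?_⟩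
  have := hf.2 _ _ (p.map φ) (hp.map hφ) (by simpa using hlen)
  simpa [Walk.support_map] using this

/-- `P_k`-colorings are preserved by injective recolorings. -/
theorem IsPkColoring.recolor {V α β : Type*} [DecidableEq α] [DecidableEq β] {G : SimpleGraph V}
    {k : ℕ} {f : V → α} (hf : IsPkColoring G k f) {g : α → β} (hg : Function.Injective g) :
    IsPkColoring G k (g ∘ f) := by
  refine ⟨fun u w h e => hf.1 _ _ h (hg e), fun u w p hp hlen => ?_⟩
  have himage : (p.support.map (g ∘ f)).toFinset = (p.support.map f).toFinset.image g := by
    ext; simp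
  rw [himage, Finset.card_image_of_injective _ hg]
  exact hf.2 _ _ p hp hlen

set_option synthInstance.maxHeartbeats 400000 in
set_option synthInstance.maxSize 1000 in
/-- Every proper 3-coloring of the `3 × 3` grid, listed row by row, has one of seven given
paths on five vertices bicolored. -/
theorem grid_three_bicolored_path : ∀ a b : Fin 3, a ≠ b → ∀ c, b ≠ c → ∀ d, a ≠ d →
    ∀ e, b ≠ e → d ≠ e → ∀ f, c ≠ f → e ≠ f → ∀ g, d ≠ g → ∀ h, e ≠ h → g ≠ h →
    ∀ i, f ≠ i → h ≠ i →
    (d = f ∧ a = e ∧ c = e) ∨ (b = f ∧ a = e ∧ i = e) ∨ (a = c ∧ d = b ∧ f = b) ∨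
    (c = i ∧ b = f ∧ h = f) ∨ (c = e ∧ b = f ∧ d = f) ∨ (b = h ∧ c = e ∧ i = e) ∨
    (f = h ∧ c = e ∧ g = e) := by
  decide +kernel

theorem not_isPkColoring_grid_three
    (f : Fin 3 × Fin 3 → Fin 3) : ¬ IsPkColoring ((pathGraph 3).boxProd (pathGraph 3)) 5 f := by
  intro hf
  obtain ⟨hp, hq⟩ := isPkColoring_five_iff.1 hf
  have adj : ∀ x y : Fin 3 × Fin 3,
      ((x.1.val + 1 = y.1.val ∨ y.1.val + 1 = x.1.val) ∧ x.2 = y.2 ∨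
        (x.2.val + 1 = y.2.val ∨ y.2.val + 1 = x.2.val) ∧ x.1 = y.1) →
      ((pathGraph 3).boxProd (pathGraph 3)).Adj x y := fun x y h => by
    rwa [boxProd_adj, pathGraph_adj, pathGraph_adj]
  have hp' : ∀ x y, _ → f x ≠ f y := fun x y h => hp x y (adj x y h)
  have hq' : ∀ v₀ v₁ v₂ v₃ v₄, _ → _ → _ → _ → _ → ¬ (f v₁ = f v₃ ∧ f v₀ = f v₂ ∧ f v₄ = f v₂) :=
    fun v₀ v₁ v₂ v₃ v₄ h₁ h₂ h₃ h₄ hnd ⟨e₁, e₂, e₃⟩ =>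
      hq v₀ v₁ v₂ v₃ v₄ (adj _ _ h₁) (adj _ _ h₂) (adj _ _ h₃) (adj _ _ h₄) hnd e₁ e₂ e₃
  rcases grid_three_bicolored_path (f (0, 0)) (f (0, 1)) (hp' _ _ (by decide))
    (f (0, 2)) (hp' _ _ (by decide)) (f (1, 0)) (hp' _ _ (by decide))
    (f (1, 1)) (hp' _ _ (by decide)) (hp' _ _ (by decide))
    (f (1, 2)) (hp' _ _ (by decide)) (hp' _ _ (by decide))
    (f (2, 0)) (hp' _ _ (by decide))
    (f (2, 1)) (hp' _ _ (by decide)) (hp' _ _ (by decide))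
    (f (2, 2)) (hp' _ _ (by decide)) (hp' _ _ (by decide)) with h | h | h | h | h | h | h <;>
  exact hq' _ _ _ _ _ (by decide) (by decide) (by decide) (by decide) (by decide) h

theorem four_le_of_isPkColoring {i j n : ℕ} (hi : 3 ≤ i) (hj : 3 ≤ j)
    {f : Fin i × Fin j → Fin n}
    (hf : IsPkColoring ((pathGraph i).boxProd (cycleGraph j)) 5 f) : 4 ≤ n := by
  by_contra! hn
  let φ : (pathGraph 3).boxProd (pathGraph 3) →g (pathGraph i).boxProd (cycleGraph j) :=
    { toFun := fun x => (Fin.castLE hi x.1, Fin.castLE hj x.2)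
      map_rel' := by
        rintro ⟨a, b⟩ ⟨c, d⟩ h
        rw [boxProd_adj, pathGraph_adj, pathGraph_adj] at h
        rw [boxProd_adj]
        refine h.imp (fun h => ⟨pathGraph_adj.2 h.1, congrArg (Fin.castLE hj) h.2⟩)
          (fun h => ⟨pathGraph_le_cycleGraph (pathGraph_adj.2 h.1), congrArg (Fin.castLE hi) h.2⟩) }
  have hφ : Function.Injective φ := by
    rintro ⟨a, b⟩ ⟨c, d⟩ h
    simpa [φ] using h
  exact not_isPkColoring_grid_three _
    ((hf.comp φ hφ).recolor (Fin.castLE_injective (Nat.le_of_lt_succ hn)))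

/-- The transitions allowed between the labels of consecutive columns: closed walks for this
relation are the concatenations of the words `012` and `0123`. -/
abbrev NextLabel (s t : Fin 4) : Prop :=
  t.val = s.val + 1 ∨ t = 0 ∧ 2 ≤ s.val

/-- The color of a vertex in row `a` and in a column labelled `t`. -/
def rowColor (a : ℤ) (t : Fin 4) : Fin 4 :=
  Fin.ofNat 4 (a % 4).toNat ^^^ t

/-- The four unit steps in the square grid. -/
def unitStep (d : Fin 4) : ℤ × ℤ :=
  ![(1, 0), (-1, 0), (0, 1), (0, -1)] d

/-- The entry of a list of five labels indexed by `-2, …, 2`. -/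
def windowLabel (l : List (Fin 4)) (b : ℤ) : Fin 4 :=
  l.getD (b + 2).toNat 0

theorem window_not_bicolored : ∀ t₀ t₁, NextLabel t₀ t₁ → ∀ t₂, NextLabel t₁ t₂ →
    ∀ t₃, NextLabel t₂ t₃ → ∀ t₄, NextLabel t₃ t₄ → ∀ r d e : Fin 4, d ≠ e →
    let color (o : ℤ × ℤ) : Fin 4 :=
      rowColor (r.val + o.1) (windowLabel [t₀, t₁, t₂, t₃, t₄] o.2)
    color (unitStep d) = color (unitStep e) →
    ∀ d', unitStep d + unitStep d' ≠ 0 → color (unitStep d + unitStep d') = color 0 →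
    ∀ e', unitStep e + unitStep e' ≠ 0 →
      unitStep d + unitStep d' ≠ unitStep e + unitStep e' →
      color (unitStep e + unitStep e') ≠ color 0 := by
  decide +kernel

theorem rowColor_step_ne : ∀ t₀ t₁, NextLabel t₀ t₁ → ∀ r : Fin 4,
    rowColor r.val t₀ ≠ rowColor r.val t₁ ∧ rowColor r.val t₀ ≠ rowColor (r.val + 1) t₀ := by
  decide +kernel

theorem rowColor_emod (a b : ℤ) (t : Fin 4) : rowColor (a % 4 + b) t = rowColor (a + b) t := by
  simp [rowColor]

/-- The coloring of the square grid whose columns have the labels `T`. -/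
def gridColor (T : ℤ → Fin 4) (p : ℤ × ℤ) : Fin 4 :=
  rowColor p.1 (T p.2)

theorem exists_fin_four_eq_emod (a : ℤ) : ∃ r : Fin 4, (r.val : ℤ) = a % 4 :=
  ⟨⟨(a % 4).toNat, by omega⟩, by simp; omega⟩

theorem gridColor_add_unitStep_ne {T : ℤ → Fin 4} (hT : ∀ b, NextLabel (T b) (T (b + 1)))
    (p : ℤ × ℤ) (d : Fin 4) : gridColor T p ≠ gridColor T (p + unitStep d) := by
  have hcol : ∀ a b, rowColor a (T b) ≠ rowColor a (T (b + 1)) := fun a b => by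
    obtain ⟨r, hr⟩ := exists_fin_four_eq_emod a
    have := (rowColor_step_ne _ _ (hT b) r).1
    rw [hr, ← add_zero (a % 4), rowColor_emod, rowColor_emod] at this
    simpa using this
  have hrow : ∀ a b, rowColor a (T b) ≠ rowColor (a + 1) (T b) := fun a b => by
    obtain ⟨r, hr⟩ := exists_fin_four_eq_emod a
    have := (rowColor_step_ne _ _ (hT b) r).2
    rw [hr, rowColor_emod] at this
    simpa [rowColor] using this
  obtain ⟨a, b⟩ := p
  fin_cases d
  · simpa [gridColor, unitStep] using hrow a b
  · simpa [gridColor, unitStep, ← sub_eq_add_neg] using (hrow (a - 1) b).symm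
  · simpa [gridColor, unitStep] using hcol a b
  · simpa [gridColor, unitStep, ← sub_eq_add_neg] using (hcol a (b - 1)).symm

theorem gridColor_not_bicolored {T : ℤ → Fin 4} (hT : ∀ b, NextLabel (T b) (T (b + 1)))
    (p : ℤ × ℤ) {d e d' e' : Fin 4} (hde : d ≠ e)
    (hd : unitStep d + unitStep d' ≠ 0) (he : unitStep e + unitStep e' ≠ 0)
    (hne : unitStep d + unitStep d' ≠ unitStep e + unitStep e')
    (h₁ : gridColor T (p + unitStep d) = gridColor T (p + unitStep e))
    (h₂ : gridColor T (p + (unitStep d + unitStep d')) = gridColor T p) :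
    gridColor T (p + (unitStep e + unitStep e')) ≠ gridColor T p := by
  obtain ⟨a, b⟩ := p
  obtain ⟨r, hr⟩ := exists_fin_four_eq_emod a
  have hwin : ∀ o : ℤ × ℤ, -2 ≤ o.2 → o.2 ≤ 2 → gridColor T ((a, b) + o) =
      rowColor (r.val + o.1)
        (windowLabel [T (b - 2), T (b - 1), T b, T (b + 1), T (b + 2)] o.2) := by
    rintro ⟨x, y⟩ h h'
    rw [hr, rowColor_emod]
    simp only at h h'
    interval_cases y <;> simp [gridColor, windowLabel, sub_eq_add_neg]
  have hstep : ∀ x, -2 ≤ (unitStep x).2 ∧ (unitStep x).2 ≤ 2 := by decide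
  have hstep' : ∀ x y, -2 ≤ (unitStep x + unitStep y).2 ∧ (unitStep x + unitStep y).2 ≤ 2 := by
    decide
  have key := window_not_bicolored (T (b - 2)) (T (b - 1)) (by convert hT (b - 2) using 2; ring)
    (T b) (by convert hT (b - 1) using 2; ring) (T (b + 1)) (hT b)
    (T (b + 2)) (by convert hT (b + 1) using 2; ring) r d e hde
  have hzero := hwin 0 (by simp) (by simp)
  rw [add_zero] at hzero
  rw [hzero] at h₂ ⊢
  rw [hwin _ (hstep _).1 (hstep _).2, hwin _ (hstep _).1 (hstep _).2] at h₁
  rw [hwin _ (hstep' _ _).1 (hstep' _ _).2] at h₂ ⊢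
  exact key h₁ d' hd h₂ e' he hne

/-- Labels following `NextLabel` cyclically exist for each length that is a sum of `3`s
and `4`s. -/
theorem exists_periodic_label {j : ℕ} (hj : 3 ≤ j) (hj5 : j ≠ 5) :
    ∃ T : ℤ → Fin 4, (∀ b, NextLabel (T b) (T (b + 1))) ∧ ∀ b, T (b % j) = T b := by
  obtain ⟨k, l, rfl⟩ : ∃ k l, j = 3 * k + 4 * l :=
    ⟨(j - 4 * (j % 3)) / 3, j % 3, by omega⟩
  let s : ℕ → Fin 4 := fun n =>
    if n < 3 * k then ⟨n % 3, by omega⟩ else ⟨(n - 3 * k) % 4, by omega⟩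
  refine ⟨fun b => s (b % (3 * k + 4 * l : ℕ)).toNat, fun b => ?_, fun b => by simp⟩
  have hlo := Int.emod_nonneg b (b := (3 * k + 4 * l : ℕ)) (by omega)
  have hhi := Int.emod_lt_of_pos b (b := (3 * k + 4 * l : ℕ)) (by omega)
  obtain ⟨n, hn⟩ := Int.eq_ofNat_of_zero_le hlo
  have hsucc : (b + 1) % (3 * k + 4 * l : ℕ) = ((n + 1) % (3 * k + 4 * l) : ℕ) := by
    rw [Int.add_emod, hn, Int.natCast_mod, ← Int.emod_add_emod]
    simp
  simp only [hn, hsucc, Int.toNat_natCast]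
  rw [hn] at hhi
  have hs : ∀ m, (s m).val = if m < 3 * k then m % 3 else (m - 3 * k) % 4 := fun m => by
    simp only [s]; split <;> rfl
  simp only [NextLabel, Fin.ext_iff, hs, Fin.val_zero]
  rcases Nat.lt_or_ge (n + 1) (3 * k + 4 * l) with h | h
  · rw [Nat.mod_eq_of_lt h]
    split_ifs <;> omega
  · rw [show n + 1 = 3 * k + 4 * l by omega, Nat.mod_self]
    obtain rfl | hl := Nat.eq_zero_or_pos l <;> split_ifs <;> omega

/-- `v` is the vertex of the cylinder covered by the point `p` of the square grid. -/
def Covers {i j : ℕ} (p : ℤ × ℤ) (v : Fin i × Fin j) : Prop :=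
  (v.1.val : ℤ) = p.1 ∧ (v.2.val : ℤ) = p.2 % j

theorem Covers.unique {i j : ℕ} {p : ℤ × ℤ} {v w : Fin i × Fin j} (hv : Covers p v)
    (hw : Covers p w) : v = w := by
  refine Prod.ext (Fin.ext ?_) (Fin.ext ?_)
  · exact_mod_cast hv.1.trans hw.1.symm
  · exact_mod_cast hv.2.trans hw.2.symm

theorem Covers.exists_step {i j : ℕ} {p : ℤ × ℤ} {v w : Fin i × Fin j}
    (hv : Covers p v) (h : ((pathGraph i).boxProd (cycleGraph j)).Adj v w) :
    ∃ d, Covers (p + unitStep d) w := by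
  obtain ⟨hv₁, hv₂⟩ := hv
  have hpos : 0 < j := v.2.pos
  have hval : ∀ x y : Fin j, (x - y).val = 1 → (x.val : ℤ) = (y.val + 1) % j := fun x y hxy => by
    have hx := x.isLt
    have hy := y.isLt
    rw [Fin.val_sub] at hxy
    have : (x.val : ℤ) % j = (y.val + 1) % j := by
      have h1 : ((j - y.val + x.val : ℕ) : ℤ) % j = 1 := by exact_mod_cast hxy
      have h2 : (y.val + 1 : ℤ) = y.val + ((j - y.val + x.val : ℕ) : ℤ) % j := by rw [h1]
      rw [h2, Int.add_emod_emod, Nat.cast_add, Nat.cast_sub hy.le]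
      rw [show (y.val : ℤ) + (j - y.val + x.val) = x.val + j by ring, Int.add_emod_right]
    rwa [Int.emod_eq_of_lt (by omega) (by omega)] at this
  rw [boxProd_adj, pathGraph_adj, cycleGraph_adj'] at h
  rcases h with ⟨h | h, e⟩ | ⟨h | h, e⟩
  · exact ⟨0, by simp [unitStep]; omega, by simp [unitStep, ← e, hv₂]⟩
  · exact ⟨1, by simp [unitStep]; omega, by simp [unitStep, ← e, hv₂]⟩
  · refine ⟨3, by simp [unitStep, ← e, hv₁], ?_⟩
    have := hval _ _ h
    have hw := w.2.isLt
    have h3 : (p.2 + -1) % j = ((w.2.val : ℤ) + 1 - 1) % j := by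
      rw [Int.sub_emod, ← this, hv₂, ← Int.sub_emod, sub_eq_add_neg]
    simp only [unitStep]
    simp [h3]
    rw [Int.emod_eq_of_lt (by omega) (by omega)]
  · refine ⟨2, by simp [unitStep, ← e, hv₁], ?_⟩
    rw [hval _ _ h, hv₂]
    simp [unitStep]

theorem exists_isPkColoring_four (i : ℕ) {j : ℕ} (hj : 3 ≤ j) (hj5 : j ≠ 5) :
    ∃ f : Fin i × Fin j → Fin 4, IsPkColoring ((pathGraph i).boxProd (cycleGraph j)) 5 f := by
  obtain ⟨T, hT, hper⟩ := exists_periodic_label hj hj5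
  let f : Fin i × Fin j → Fin 4 := fun v => gridColor T (v.1.val, v.2.val)
  have hf : ∀ {p v}, Covers p v → f v = gridColor T p := fun {p v} h => by
    simp only [f, gridColor, h.1, h.2, hper]
  have hself : ∀ v : Fin i × Fin j, Covers ((v.1.val : ℤ), (v.2.val : ℤ)) v := fun v =>
    ⟨rfl, (Int.emod_eq_of_lt (by omega) (by omega)).symm⟩
  refine ⟨f, isPkColoring_five_iff.2 ⟨fun u w h => ?_, ?_⟩⟩
  · obtain ⟨d, hd⟩ := (hself u).exists_step h
    rw [hf (hself u), hf hd]
    exact gridColor_add_unitStep_ne hT _ d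
  · intro v₀ v₁ v₂ v₃ v₄ a₁ a₂ a₃ a₄ hnd
    have c₂ := hself v₂
    obtain ⟨d, c₁⟩ := c₂.exists_step a₂.symm
    obtain ⟨e, c₃⟩ := c₂.exists_step a₃
    obtain ⟨d', c₀⟩ := c₁.exists_step a₁.symm
    obtain ⟨e', c₄⟩ := c₃.exists_step a₄
    rw [add_assoc] at c₀ c₄
    rw [hf c₀, hf c₁, hf c₂, hf c₃, hf c₄]
    simp only [List.nodup_cons, List.mem_cons, not_or] at hnd
    refine gridColor_not_bicolored hT _ ?_ ?_ ?_ ?_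
    · rintro rfl
      exact hnd.2.1.2.1 (c₁.unique c₃)
    · intro h
      rw [h, add_zero] at c₀
      exact hnd.1.2.1 (c₀.unique c₂)
    · intro h
      rw [h, add_zero] at c₄
      exact hnd.2.2.1.2.1 (c₂.unique c₄)
    · intro h
      rw [h] at c₀
      exact hnd.1.2.2.2.1 (c₀.unique c₄)

theorem s5_path_boxProd_cycle (i j : ℕ) (hi : 3 ≤ i) (hj : 3 ≤ j)
    (hi5 : i ≠ 5) (hj5 : j ≠ 5) :
    pkChrom ((pathGraph i).boxProd (cycleGraph j)) 5 = 4 := by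
  have hmem := exists_isPkColoring_four i hj hj5
  exact le_antisymm (Nat.sInf_le hmem)
    (le_csInf ⟨4, hmem⟩ fun n ⟨f, hf⟩ => four_le_of_isPkColoring hi hj hf)
end

section
/- The P_6-chromatic number of the 4×4 grid graph equals 4: s_6(P_4 □ P_4) = 4. -/
open SimpleGraph

/-- The six-term sequence `a, b, c, d, e, g` alternates between two values. -/
abbrev Alternating {α : Type*} (a b c d e g : α) : Prop :=
  c = a ∧ d = b ∧ e = a ∧ g = b

/-- A proper coloring is a `P_6`-coloring exactly when no path on six vertices alternates
between two colors. -/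
theorem isPkColoring_six_iff {V α : Type*} [DecidableEq α] {G : SimpleGraph V} {f : V → α} :
    IsPkColoring G 6 f ↔ (∀ u w : V, G.Adj u w → f u ≠ f w) ∧
      ∀ v₀ v₁ v₂ v₃ v₄ v₅ : V, [v₀, v₁, v₂, v₃, v₄, v₅].IsChain G.Adj →
        [v₀, v₁, v₂, v₃, v₄, v₅].Nodup →
        ¬ Alternating (f v₀) (f v₁) (f v₂) (f v₃) (f v₄) (f v₅) := by
  refine and_congr_right fun hf => ⟨fun h v₀ v₁ v₂ v₃ v₄ v₅ hc hn ha => ?_,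
    fun h u w p hp hl => ?_⟩
  · have h3 := h _ _ (Walk.ofSupport _ (List.cons_ne_nil _ _) hc)
      (by rwa [Walk.isPath_def, Walk.support_ofSupport]) (by simp)
    obtain ⟨h₂, h₃, h₄, h₅⟩ := ha
    have hsub : ([v₀, v₁, v₂, v₃, v₄, v₅].map f).toFinset ⊆ {f v₀, f v₁} := by
      intro x; simp [h₂, h₃, h₄, h₅]
    rw [Walk.support_ofSupport] at h3
    have := Finset.card_le_card hsub
    have := Finset.card_le_two (a := f v₀) (b := f v₁)
    omega
  · obtain ⟨v₀, v₁, v₂, v₃, v₄, v₅, hs⟩ :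
        ∃ v₀ v₁ v₂ v₃ v₄ v₅, p.support = [v₀, v₁, v₂, v₃, v₄, v₅] := by
      have := p.length_support.trans hl
      match p.support, this with
      | [v₀, v₁, v₂, v₃, v₄, v₅], _ => exact ⟨v₀, v₁, v₂, v₃, v₄, v₅, rfl⟩
    have hc := p.isChain_adj_support
    have hn := hp.support_nodup
    rw [hs] at hc hn ⊢
    have ha := h _ _ _ _ _ _ hc hn
    by_contra hlt
    have hsub : {f v₀, f v₁} ⊆ ([v₀, v₁, v₂, v₃, v₄, v₅].map f).toFinset := by
      intro x; simp; tauto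
    simp only [List.isChain_cons_cons, List.isChain_singleton, and_true] at hc
    have heq := Finset.eq_of_subset_of_card_le hsub
      (by rw [Finset.card_pair (hf _ _ hc.1)]; omega)
    have hmem : ∀ v ∈ [v₀, v₁, v₂, v₃, v₄, v₅], f v = f v₀ ∨ f v = f v₁ := by
      intro v hv
      have : f v ∈ ({f v₀, f v₁} : Finset α) := by
        rw [heq, List.mem_toFinset]; exact List.mem_map_of_mem hv
      simpa using this
    have h₁₂ := hf _ _ hc.2.1
    have h₂₃ := hf _ _ hc.2.2.1
    have h₃₄ := hf _ _ hc.2.2.2.1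
    have h₄₅ := hf _ _ hc.2.2.2.2
    simp only [List.mem_cons, List.not_mem_nil, or_false, forall_eq_or_imp, forall_eq] at hmem
    grind

/-- Relabeling the colors injectively keeps a `P_k`-coloring. -/
theorem IsPkColoring.comp_injective {V α β : Type*} [DecidableEq α] [DecidableEq β]
    {G : SimpleGraph V} {k : ℕ} {f : V → α} (h : IsPkColoring G k f) {g : α → β}
    (hg : g.Injective) : IsPkColoring G k (g ∘ f) := by
  refine ⟨fun u w huw => hg.ne (h.1 u w huw), fun u w p hp hk => ?_⟩
  have himage : (p.support.map (g ∘ f)).toFinset = (p.support.map f).toFinset.image g := by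
    ext; simp
  rw [himage, Finset.card_image_of_injective _ hg]
  exact h.2 u w p hp hk

instance {n : ℕ} : DecidableRel (pathGraph n).Adj :=
  fun _ _ => decidable_of_iff' _ pathGraph_adj

instance {V W : Type*} [DecidableEq V] [DecidableEq W] (G : SimpleGraph V) (H : SimpleGraph W)
    [DecidableRel G.Adj] [DecidableRel H.Adj] : DecidableRel (G.boxProd H).Adj :=
  fun _ _ => decidable_of_iff' _ boxProd_adj

set_option synthInstance.maxHeartbeats 400000 in
set_option synthInstance.maxSize 10000 in
/-- In any `3`-coloring of the `4 × 4` grid, with rows `a`, `b`, `c`, `d`, some edge is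
monochromatic or some path on six vertices alternates between two colors. -/
theorem no_three_colors :
    ∀ a₀ : Fin 3,
    ∀ a₁ : Fin 3, a₀ ≠ a₁ →
    ∀ a₂ : Fin 3, a₁ ≠ a₂ →
    ∀ a₃ : Fin 3, a₂ ≠ a₃ →
    ∀ b₀ : Fin 3, a₀ ≠ b₀ →
    ∀ b₁ : Fin 3, a₁ ≠ b₁ → b₀ ≠ b₁ →
    ∀ b₂ : Fin 3, a₂ ≠ b₂ → b₁ ≠ b₂ → ¬ Alternating a₀ b₀ b₁ b₂ a₂ a₃ →
    ∀ b₃ : Fin 3, a₃ ≠ b₃ → b₂ ≠ b₃ →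
    ∀ c₀ : Fin 3, b₀ ≠ c₀ → ¬ Alternating a₃ b₃ b₂ b₁ b₀ c₀ → ¬ Alternating b₂ a₂ a₁ a₀ b₀ c₀ →
    ∀ c₁ : Fin 3, b₁ ≠ c₁ → c₀ ≠ c₁ → ¬ Alternating a₃ a₂ a₁ b₁ c₁ c₀ →
    ∀ c₂ : Fin 3, b₂ ≠ c₂ → c₁ ≠ c₂ → ¬ Alternating a₁ b₁ c₁ c₂ b₂ b₃ →
      ¬ Alternating a₂ b₂ c₂ c₁ c₀ b₀ →
    ∀ c₃ : Fin 3, b₃ ≠ c₃ → c₂ ≠ c₃ → ¬ Alternating a₀ a₁ b₁ b₂ c₂ c₃ →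
      ¬ Alternating a₀ b₀ b₁ b₂ b₃ c₃ → ¬ Alternating a₀ b₀ b₁ c₁ c₂ c₃ →
      ¬ Alternating a₂ b₂ b₃ c₃ c₂ c₁ → ¬ Alternating a₃ b₃ c₃ c₂ c₁ b₁ →
      ¬ Alternating c₀ b₀ b₁ b₂ c₂ c₃ → ¬ Alternating c₀ c₁ b₁ b₂ b₃ c₃ →
    ∀ d₀ : Fin 3, c₀ ≠ d₀ → ¬ Alternating a₂ a₁ b₁ b₀ c₀ d₀ →
    ∀ d₁ : Fin 3, c₁ ≠ d₁ → d₀ ≠ d₁ → ¬ Alternating a₁ a₀ b₀ c₀ c₁ d₁ →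
      ¬ Alternating a₂ a₁ b₁ c₁ d₁ d₀ → ¬ Alternating b₂ b₁ c₁ d₁ d₀ c₀ →
      ¬ Alternating b₃ b₂ c₂ c₁ d₁ d₀ →
    ∀ d₂ : Fin 3, c₂ ≠ d₂ → d₁ ≠ d₂ → ¬ Alternating a₂ a₁ b₁ c₁ c₂ d₂ →
      ¬ Alternating a₂ b₂ c₂ d₂ d₁ d₀ → ¬ Alternating c₀ c₁ b₁ b₂ c₂ d₂ →
    ∀ d₃ : Fin 3, c₃ ≠ d₃ → d₂ ≠ d₃ → ¬ Alternating a₁ a₂ b₂ c₂ d₂ d₃ →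
      ¬ Alternating b₀ b₁ b₂ c₂ d₂ d₃ → False := by
  decide +kernel

/-- A `P_6`-coloring of the `4 × 4` grid with four colors. -/
def gridColoring (v : Fin 4 × Fin 4) : Fin 4 :=
  (![![0, 1, 0, 1], ![1, 2, 1, 2], ![3, 0, 2, 0], ![0, 1, 0, 1]] : Fin 4 → Fin 4 → Fin 4) v.1 v.2

set_option synthInstance.maxHeartbeats 400000 in
set_option synthInstance.maxSize 10000 in
theorem gridColoring_isPkColoring :
    IsPkColoring ((pathGraph 4).boxProd (pathGraph 4)) 6 gridColoring := by
  have key : ∀ v₀ v₁, ((pathGraph 4).boxProd (pathGraph 4)).Adj v₀ v₁ →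
      gridColoring v₀ ≠ gridColoring v₁ ∧
      ∀ v₂, ((pathGraph 4).boxProd (pathGraph 4)).Adj v₁ v₂ → v₂ ≠ v₀ →
        gridColoring v₂ = gridColoring v₀ →
      ∀ v₃, ((pathGraph 4).boxProd (pathGraph 4)).Adj v₂ v₃ → v₃ ≠ v₁ →
        gridColoring v₃ = gridColoring v₁ →
      ∀ v₄, ((pathGraph 4).boxProd (pathGraph 4)).Adj v₃ v₄ → v₄ ≠ v₀ → v₄ ≠ v₂ →
        gridColoring v₄ = gridColoring v₀ →
      ∀ v₅, ((pathGraph 4).boxProd (pathGraph 4)).Adj v₄ v₅ → v₅ ≠ v₁ → v₅ ≠ v₃ →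
        gridColoring v₅ ≠ gridColoring v₁ := by
    decide +kernel
  refine isPkColoring_six_iff.2 ⟨fun u w h => (key u w h).1, ?_⟩
  rintro v₀ v₁ v₂ v₃ v₄ v₅ hc hn ⟨h₂, h₃, h₄, h₅⟩
  simp only [List.isChain_cons_cons, List.isChain_singleton, and_true] at hc
  obtain ⟨c₁, c₂, c₃, c₄, c₅⟩ := hc
  simp only [List.nodup_cons, List.mem_cons, List.not_mem_nil, or_false, not_or] at hn
  exact (key v₀ v₁ c₁).2 v₂ c₂ (by grind) h₂ v₃ c₃ (by grind) h₃ v₄ c₄ (by grind) (by grind) h₄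
    v₅ c₅ (by grind) (by grind) h₅

theorem not_isPkColoring_fin_three (f : Fin 4 × Fin 4 → Fin 3) :
    ¬ IsPkColoring ((pathGraph 4).boxProd (pathGraph 4)) 6 f := by
  rw [isPkColoring_six_iff]
  rintro ⟨he, hp⟩
  refine no_three_colors (f (0, 0)) (f (0, 1)) ?_ (f (0, 2)) ?_ (f (0, 3)) ?_ (f (1, 0)) ?_
    (f (1, 1)) ?_ ?_ (f (1, 2)) ?_ ?_ ?_ (f (1, 3)) ?_ ?_ (f (2, 0)) ?_ ?_ ?_ (f (2, 1)) ?_ ?_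
    ?_ (f (2, 2)) ?_ ?_ ?_ ?_ (f (2, 3)) ?_ ?_ ?_ ?_ ?_ ?_ ?_ ?_ ?_ (f (3, 0)) ?_ ?_ (f (3, 1))
    ?_ ?_ ?_ ?_ ?_ ?_ (f (3, 2)) ?_ ?_ ?_ ?_ ?_ (f (3, 3)) ?_ ?_ ?_ ?_
  all_goals first
    | exact he _ _ (by decide)
    | exact hp _ _ _ _ _ _ (by decide) (by decide)

theorem s6_P4_boxProd_P4 :
    pkChrom ((pathGraph 4).boxProd (pathGraph 4)) 6 = 4 := by
  refine le_antisymm (Nat.sInf_le ⟨gridColoring, gridColoring_isPkColoring⟩)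
    (le_csInf ⟨4, gridColoring, gridColoring_isPkColoring⟩ ?_)
  rintro n ⟨f, hf⟩
  by_contra! hn
  exact not_isPkColoring_fin_three _
    (hf.comp_injective (Fin.castLE_injective (Nat.le_of_lt_succ hn)))
end
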